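/- arXiv:1203.1437 — 6 statements merged into one kernel-verified Lean document; each statement's English description precedes it below -/
import Mathlib

section
/- For all smooth functions h, k : ℝ^(2n) → ℝ, the Jacobi–Lie bracket of their Hamiltonian vector fields satisfies [X_h, X_k] = −X_{{h,k}}. In particular, the Hamiltonian vector fields on ℝ^(2n) are closed under the Jacobi–Lie bracket, so they form a Lie subalgebra of the Lie algebra of all smooth vector fields, and the map h ↦ X_h is an anti-homomorphism from the canonical Poisson bracket algebra of functions to the Jacobi–Lie bracket algebra of vector fields. -/
noncomputable section

/-- Canonical symplectic form `ω = dp ∧ dq` on `ℝⁿ × ℝⁿ`: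
`ω((q̇₁,ṗ₁),(q̇₂,ṗ₂)) = ⟨ṗ₁,q̇₂⟩ − ⟨ṗ₂,q̇₁⟩`. -/
def omega (n : ℕ) (u v : (Fin n → ℝ) × (Fin n → ℝ)) : ℝ :=
  (∑ i, u.2 i * v.1 i) - (∑ i, v.2 i * u.1 i)

/-- Hamiltonian vector field `X_h(q,p) = (∇_p h, −∇_q h)`. -/
def Xham (n : ℕ) (h : (Fin n → ℝ) × (Fin n → ℝ) → ℝ) :
    (Fin n → ℝ) × (Fin n → ℝ) → (Fin n → ℝ) × (Fin n → ℝ) := fun z =>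
  (fun i => fderiv ℝ h z (0, Pi.single i 1), fun i => -(fderiv ℝ h z (Pi.single i 1, 0)))

/-- Canonical Poisson bracket `{h,k} = ∇_q h · ∇_p k − ∇_p h · ∇_q k`. -/
def poisson (n : ℕ) (h k : (Fin n → ℝ) × (Fin n → ℝ) → ℝ)
    (z : (Fin n → ℝ) × (Fin n → ℝ)) : ℝ :=
  (∑ i, fderiv ℝ h z (Pi.single i 1, 0) * fderiv ℝ k z (0, Pi.single i 1)) -
  (∑ i, fderiv ℝ h z (0, Pi.single i 1) * fderiv ℝ k z (Pi.single i 1, 0))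

/-- Jacobi–Lie bracket `[X,Y](z) = DY(z) X(z) − DX(z) Y(z)`. -/
def jacobiLie {E : Type*} [NormedAddCommGroup E] [NormedSpace ℝ E] (X Y : E → E) : E → E :=
  fun z => fderiv ℝ Y z (X z) - fderiv ℝ X z (Y z)

/-- A linear functional on `ℝⁿ × ℝⁿ` expanded in the standard coordinates. -/
lemma clm_apply_eq_sum_single {n : ℕ} (L : (Fin n → ℝ) × (Fin n → ℝ) →L[ℝ] ℝ)
    (u : (Fin n → ℝ) × (Fin n → ℝ)) :
    L u = (∑ i, u.1 i * L (Pi.single i 1, 0)) + ∑ i, u.2 i * L (0, Pi.single i 1) := by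
  have h1 := LinearMap.pi_apply_eq_sum_univ
    ((L.comp (ContinuousLinearMap.inl ℝ _ _)).toLinearMap) u.1
  have h2 := LinearMap.pi_apply_eq_sum_univ
    ((L.comp (ContinuousLinearMap.inr ℝ _ _)).toLinearMap) u.2
  have hs : ∀ i : Fin n, (fun j => if i = j then (1 : ℝ) else 0) = Pi.single i 1 := by
    intro i
    ext j
    simp [Pi.single_apply, eq_comm]
  simp only [hs] at h1 h2
  simp only [ContinuousLinearMap.coe_coe, ContinuousLinearMap.comp_apply,
    ContinuousLinearMap.inl_apply, ContinuousLinearMap.inr_apply, smul_eq_mul] at h1 h2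
  rw [← h1, ← h2, ← map_add]
  simp

lemma hasFDerivAt_fderiv_apply {E : Type*} [NormedAddCommGroup E] [NormedSpace ℝ E] {h : E → ℝ}
    (hh : ContDiff ℝ (⊤ : ℕ∞) h) (z w : E) :
    HasFDerivAt (fun y => fderiv ℝ h y w) ((fderiv ℝ (fderiv ℝ h) z).flip w) z := by
  have hd : Differentiable ℝ (fderiv ℝ h) :=
    (hh.fderiv_right (m := 1) (by norm_cast)).differentiable (by norm_num)
  have := (hd z).hasFDerivAt.clm_apply (hasFDerivAt_const w z)
  simpa using this

lemma fderiv_fderiv_comm {E : Type*} [NormedAddCommGroup E] [NormedSpace ℝ E] {h : E → ℝ}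
    (hh : ContDiff ℝ (⊤ : ℕ∞) h) (z u v : E) :
    fderiv ℝ (fderiv ℝ h) z u v = fderiv ℝ (fderiv ℝ h) z v u :=
  (hh.contDiffAt.isSymmSndFDerivAt (by simp; norm_cast)).eq u v

lemma fderiv_Xham_apply {n : ℕ} {h : (Fin n → ℝ) × (Fin n → ℝ) → ℝ}
    (hh : ContDiff ℝ (⊤ : ℕ∞) h) (z v : (Fin n → ℝ) × (Fin n → ℝ)) :
    fderiv ℝ (Xham n h) z v =
      (fun i => fderiv ℝ (fderiv ℝ h) z v (0, Pi.single i 1),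
        fun i => -fderiv ℝ (fderiv ℝ h) z v (Pi.single i 1, 0)) := by
  have h1 := hasFDerivAt_pi.2 fun i : Fin n => hasFDerivAt_fderiv_apply hh z (0, Pi.single i 1)
  have h2 := hasFDerivAt_pi.2 fun i : Fin n =>
    (hasFDerivAt_fderiv_apply hh z (Pi.single i 1, 0)).neg
  have h3 : HasFDerivAt (Xham n h) _ z := h1.prodMk h2
  rw [h3.fderiv]
  rfl

lemma fderiv_poisson_apply {n : ℕ} {h k : (Fin n → ℝ) × (Fin n → ℝ) → ℝ}
    (hh : ContDiff ℝ (⊤ : ℕ∞) h) (hk : ContDiff ℝ (⊤ : ℕ∞) k)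
    (z v : (Fin n → ℝ) × (Fin n → ℝ)) :
    fderiv ℝ (poisson n h k) z v =
      fderiv ℝ (fderiv ℝ h) z v (Xham n k z) - fderiv ℝ (fderiv ℝ k) z v (Xham n h z) := by
  have h1 := (HasFDerivAt.fun_sum (u := Finset.univ) fun (i : Fin n) _ =>
    (hasFDerivAt_fderiv_apply hh z (Pi.single i 1, 0)).mul
      (hasFDerivAt_fderiv_apply hk z (0, Pi.single i 1))).sub
    (HasFDerivAt.fun_sum (u := Finset.univ) fun (i : Fin n) _ =>
    (hasFDerivAt_fderiv_apply hh z (0, Pi.single i 1)).mul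
      (hasFDerivAt_fderiv_apply hk z (Pi.single i 1, 0)))
  have h2 : HasFDerivAt (poisson n h k) _ z := h1
  rw [h2.fderiv, clm_apply_eq_sum_single (fderiv ℝ (fderiv ℝ h) z v) (Xham n k z),
    clm_apply_eq_sum_single (fderiv ℝ (fderiv ℝ k) z v) (Xham n h z)]
  simp only [sub_apply, sum_apply,
    add_apply, smul_apply, ContinuousLinearMap.flip_apply,
    smul_eq_mul, Xham, Finset.sum_add_distrib, neg_mul, Finset.sum_neg_distrib]
  ring

lemma contDiff_poisson {n : ℕ} {h k : (Fin n → ℝ) × (Fin n → ℝ) → ℝ}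
    (hh : ContDiff ℝ (⊤ : ℕ∞) h) (hk : ContDiff ℝ (⊤ : ℕ∞) k) :
    ContDiff ℝ (⊤ : ℕ∞) (poisson n h k) := by
  have key : ∀ {f : (Fin n → ℝ) × (Fin n → ℝ) → ℝ}, ContDiff ℝ (⊤ : ℕ∞) f → ∀ w,
      ContDiff ℝ (⊤ : ℕ∞) fun z => fderiv ℝ f z w := fun hf w =>
    (hf.fderiv_right (m := (⊤ : ℕ∞)) (by norm_cast)).clm_apply contDiff_const
  exact (ContDiff.sum fun i _ => (key hh _).mul (key hk _)).sub
    (ContDiff.sum fun i _ => (key hh _).mul (key hk _))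

lemma jacobiLie_Xham {n : ℕ} {h k : (Fin n → ℝ) × (Fin n → ℝ) → ℝ}
    (hh : ContDiff ℝ (⊤ : ℕ∞) h) (hk : ContDiff ℝ (⊤ : ℕ∞) k) :
    jacobiLie (Xham n h) (Xham n k) = fun z => -(Xham n (poisson n h k) z) := by
  funext z
  rw [jacobiLie, fderiv_Xham_apply hk, fderiv_Xham_apply hh]
  ext i
  · simp only [Xham, Prod.fst_sub, Prod.fst_neg, Pi.sub_apply, Pi.neg_apply,
      fderiv_poisson_apply hh hk]
    rw [fderiv_fderiv_comm hh z (0, _), fderiv_fderiv_comm hk z (0, _)]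
    ring
  · simp only [Xham, Prod.snd_sub, Prod.snd_neg, Pi.sub_apply, Pi.neg_apply,
      fderiv_poisson_apply hh hk]
    rw [fderiv_fderiv_comm hh z (_, 0), fderiv_fderiv_comm hk z (_, 0)]
    ring

lemma Xham_neg {n : ℕ} (h : (Fin n → ℝ) × (Fin n → ℝ) → ℝ) :
    Xham n (-h) = fun z => -(Xham n h z) := by
  funext z
  ext i <;> simp [Xham, fderiv_neg]

/-- For smooth `h, k`, `[X_h, X_k] = −X_{{h,k}}`; in particular Hamiltonian vector fields
are closed under the Jacobi–Lie bracket. -/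
theorem stmt0 (n : ℕ) :
    (∀ h k : (Fin n → ℝ) × (Fin n → ℝ) → ℝ, ContDiff ℝ (⊤ : ℕ∞) h → ContDiff ℝ (⊤ : ℕ∞) k →
      jacobiLie (Xham n h) (Xham n k) = fun z => -(Xham n (poisson n h k) z)) ∧
    (∀ h k : (Fin n → ℝ) × (Fin n → ℝ) → ℝ, ContDiff ℝ (⊤ : ℕ∞) h → ContDiff ℝ (⊤ : ℕ∞) k →
      ∃ g : (Fin n → ℝ) × (Fin n → ℝ) → ℝ, ContDiff ℝ (⊤ : ℕ∞) g ∧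
        jacobiLie (Xham n h) (Xham n k) = Xham n g) := by
  refine ⟨fun h k hh hk => jacobiLie_Xham hh hk, fun h k hh hk => ?_⟩
  exact ⟨-poisson n h k, (contDiff_poisson hh hk).neg, by
    rw [jacobiLie_Xham hh hk, Xham_neg]⟩
end
end

section
/- Let h : ℝ^(2n) → ℝ be smooth with Hamiltonian vector field X_h, and let Y be a smooth vector field on ℝ^(2n) which is an infinitesimal homothety of the canonical symplectic form ω with constant factor λ ∈ ℝ, i.e. ω(DY(z)u, v) + ω(u, DY(z)v) = λ·ω(u,v) for all z, u, v. Then the Jacobi–Lie bracket [X_h, Y] is a globally Hamiltonian vector field; explicitly, [X_h, Y] = X_g for the smooth function g(z) = λ·h(z) − ω(Y(z), X_h(z)). -/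
noncomputable section

lemma omega_neg_swap (n : ℕ) (u v : (Fin n → ℝ) × (Fin n → ℝ)) :
    omega n u v = -omega n v u := by
  simp only [omega]
  ring

lemma omega_sub_left (n : ℕ) (u u' v : (Fin n → ℝ) × (Fin n → ℝ)) :
    omega n (u - u') v = omega n u v - omega n u' v := by
  simp only [omega, Prod.fst_sub, Prod.snd_sub, Pi.sub_apply, sub_mul, mul_sub,
    Finset.sum_sub_distrib]
  ring

/-- The linear form `u ↦ ω(u, v)`. -/
def omegaFlip (n : ℕ) (v : (Fin n → ℝ) × (Fin n → ℝ)) :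
    (Fin n → ℝ) × (Fin n → ℝ) →L[ℝ] ℝ :=
  LinearMap.toContinuousLinearMap
    { toFun := fun u => omega n u v
      map_add' := fun u u' => by
        simp only [omega, Prod.fst_add, Prod.snd_add, Pi.add_apply, add_mul, mul_add,
          Finset.sum_add_distrib]
        ring
      map_smul' := fun c u => by
        simp only [omega, Prod.smul_fst, Prod.smul_snd, Pi.smul_apply, smul_eq_mul,
          RingHom.id_apply, mul_sub, Finset.mul_sum, mul_assoc, mul_left_comm] }

@[simp]
lemma omegaFlip_apply (n : ℕ) (u v : (Fin n → ℝ) × (Fin n → ℝ)) :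
    omegaFlip n v u = omega n u v := rfl

lemma omega_single_fst (n : ℕ) (u : (Fin n → ℝ) × (Fin n → ℝ)) (i : Fin n) :
    omega n u (Pi.single i 1, 0) = u.2 i := by
  simp [omega, Pi.single_apply]

lemma omega_single_snd (n : ℕ) (u : (Fin n → ℝ) × (Fin n → ℝ)) (i : Fin n) :
    omega n u (0, Pi.single i 1) = -u.1 i := by
  simp [omega, Pi.single_apply]

/-- Defining property of the Hamiltonian vector field: `ω(X_h(z), v) = -Dh(z) v`. -/
lemma omega_Xham (n : ℕ) (h : (Fin n → ℝ) × (Fin n → ℝ) → ℝ)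
    (z v : (Fin n → ℝ) × (Fin n → ℝ)) :
    omega n (Xham n h z) v = -fderiv ℝ h z v := by
  have hv : v = ∑ i, (v.1 i • ((Pi.single i 1, 0) : (Fin n → ℝ) × (Fin n → ℝ)) +
      v.2 i • ((0, Pi.single i 1) : (Fin n → ℝ) × (Fin n → ℝ))) := by
    ext j <;> simp [Prod.fst_sum, Prod.snd_sum, Finset.sum_apply, Pi.single_apply]
  conv_rhs => rw [hv]
  simp only [map_sum, map_add, map_smul, smul_eq_mul, Finset.sum_add_distrib, omega, Xham,
    neg_mul, Finset.sum_neg_distrib, mul_comm (v.1 _)]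
  ring

/-- Nondegeneracy of `ω` identifies the Hamiltonian vector field by its defining property. -/
lemma eq_Xham_of_omega (n : ℕ) (g : (Fin n → ℝ) × (Fin n → ℝ) → ℝ)
    (z w : (Fin n → ℝ) × (Fin n → ℝ)) (hw : ∀ v, omega n w v = -fderiv ℝ g z v) :
    w = Xham n g z := by
  ext i
  · simpa [omega_single_snd, Xham] using hw (0, Pi.single i 1)
  · simpa [omega_single_fst, Xham] using hw (Pi.single i 1, 0)

lemma differentiable_Xham (n : ℕ) {h : (Fin n → ℝ) × (Fin n → ℝ) → ℝ}
    (hdh : Differentiable ℝ (fderiv ℝ h)) : Differentiable ℝ (Xham n h) := by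
  unfold Xham
  fun_prop

lemma omega_fderiv_Xham (n : ℕ) {h : (Fin n → ℝ) × (Fin n → ℝ) → ℝ}
    (hdh : Differentiable ℝ (fderiv ℝ h)) (z w v : (Fin n → ℝ) × (Fin n → ℝ)) :
    omega n (fderiv ℝ (Xham n h) z w) v = -fderiv ℝ (fderiv ℝ h) z w v := by
  have h₁ := (omegaFlip n v).hasFDerivAt.comp z (differentiable_Xham n hdh z).hasFDerivAt
  have h₂ := ((hdh z).hasFDerivAt.clm_apply (hasFDerivAt_const v z)).neg
  have hfun : (omegaFlip n v) ∘ Xham n h = -fun y => fderiv ℝ h y v :=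
    funext fun y => omega_Xham n h y v
  rw [hfun] at h₁
  simpa using DFunLike.congr_fun (h₁.unique h₂) w

/-- If `Y` is an infinitesimal homothety of `ω` with constant factor `λ`, then
`[X_h, Y]` is globally Hamiltonian with Hamiltonian `g(z) = λ·h(z) − ω(Y(z), X_h(z))`. -/
theorem stmt1 (n : ℕ) (h : (Fin n → ℝ) × (Fin n → ℝ) → ℝ)
    (Y : (Fin n → ℝ) × (Fin n → ℝ) → (Fin n → ℝ) × (Fin n → ℝ)) (lam : ℝ)
    (hh : ContDiff ℝ (⊤ : ℕ∞) h) (hY : ContDiff ℝ (⊤ : ℕ∞) Y)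
    (hhom : ∀ z u v, omega n (fderiv ℝ Y z u) v + omega n u (fderiv ℝ Y z v)
      = lam * omega n u v) :
    jacobiLie (Xham n h) Y =
      Xham n (fun z => lam * h z - omega n (Y z) (Xham n h z)) := by
  have hdh : Differentiable ℝ (fderiv ℝ h) :=
    (hh.fderiv_right (m := 1) (by norm_cast)).differentiable one_ne_zero
  have hdY : Differentiable ℝ Y := hY.differentiable (by simp)
  funext z
  refine eq_Xham_of_omega n _ z _ fun v => ?_
  have hg : (fun z => lam * h z - omega n (Y z) (Xham n h z)) =
      fun z => lam * h z - fderiv ℝ h z (Y z) := by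
    funext y
    rw [omega_neg_swap, omega_Xham, neg_neg]
  have hderiv : fderiv ℝ (fun z => lam * h z - fderiv ℝ h z (Y z)) z = _ :=
    (((hh.differentiable (by simp) z).hasFDerivAt.const_mul lam).sub
      ((hdh z).hasFDerivAt.clm_apply (hdY z).hasFDerivAt)).fderiv
  have hsymm : fderiv ℝ (fderiv ℝ h) z v (Y z) = fderiv ℝ (fderiv ℝ h) z (Y z) v :=
    ((hh.of_le (m := 2) (by norm_cast)).contDiffAt.isSymmSndFDerivAt
      (by simp)).eq v (Y z)
  have hhomX := hhom z (Xham n h z) v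
  rw [omega_Xham, omega_Xham] at hhomX
  have hgv := DFunLike.congr_fun hderiv v
  simp only [sub_apply, add_apply, smul_apply, ContinuousLinearMap.comp_apply,
    ContinuousLinearMap.flip_apply, smul_eq_mul] at hgv
  rw [hg, jacobiLie, omega_sub_left, omega_fderiv_Xham n hdh, hgv]
  linarith
end
end

section
/- Let φ : ℝ × ℝ³ → ℝ and Π = (Π_q, Π_p) : ℝ × ℝ⁶ → ℝ³ × ℝ³ be smooth and suppose Π satisfies the momentum-Vlasov equations ∂Π_q/∂t = −X_h(Π_q) + e(Π_p·∇_q)(∇_qφ) and ∂Π_p/∂t = −X_h(Π_p) − Π_q/m, where X_h(g) := (p/m)·∇_q g − e∇_qφ·∇_p g and e, m are constants with m ≠ 0. Then the function f := ∇_p·Π_q − ∇_q·Π_p satisfies the Vlasov equation ∂f/∂t + (p/m)·∇_q f − e∇_qφ·∇_p f = 0. -/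
noncomputable section

/-- Configuration space `ℝ³`. -/
abbrev E3 := Fin 3 → ℝ

/-- Particle phase space `ℝ⁶ = ℝ³ × ℝ³`. -/
abbrev P6 := E3 × E3

/-- Partial derivative `∂g/∂q_i`. -/
def dq3 (g : P6 → ℝ) (z : P6) (i : Fin 3) : ℝ := fderiv ℝ g z (Pi.single i 1, 0)

/-- Partial derivative `∂g/∂p_i`. -/
def dp3 (g : P6 → ℝ) (z : P6) (i : Fin 3) : ℝ := fderiv ℝ g z (0, Pi.single i 1)

/-- The action of the particle Hamiltonian vector field on functions:
`X_h(g) = (p/m)·∇_q g − e∇_qφ·∇_p g` (for a fixed-time potential `φt`). -/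
def Xact (e m : ℝ) (φt : E3 → ℝ) (g : P6 → ℝ) (z : P6) : ℝ :=
  (∑ i, (z.2 i / m) * dq3 g z i) -
  (∑ i, e * fderiv ℝ φt z.1 (Pi.single i 1) * dp3 g z i)

/-- Second derivative `∂²φ/∂q_i∂q_j` of a fixed-time potential. -/
def d2φ (φt : E3 → ℝ) (q : E3) (i j : Fin 3) : ℝ :=
  fderiv ℝ (fun q' => fderiv ℝ φt q' (Pi.single j 1)) q (Pi.single i 1)

/-- The plasma density `f = ∇_p·Π_q − ∇_q·Π_p`. -/
def dens (Pim : ℝ × P6 → E3 × E3) (t : ℝ) (z : P6) : ℝ :=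
  (∑ i, dp3 (fun w => (Pim (t, w)).1 i) z i) - (∑ i, dq3 (fun w => (Pim (t, w)).2 i) z i)

/-- The derivative of `G` in the fixed direction `v`. -/
def dirDeriv {E : Type*} [NormedAddCommGroup E] [NormedSpace ℝ E] (v : E) (G : E → ℝ) (x : E) : ℝ :=
  fderiv ℝ G x v

section DirDeriv

variable {E : Type*} [NormedAddCommGroup E] [NormedSpace ℝ E] {F G : E → ℝ}

lemma contDiff_dirDeriv (hG : ContDiff ℝ (⊤ : ℕ∞) G) (v : E) :
    ContDiff ℝ (⊤ : ℕ∞) (dirDeriv v G) :=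
  (hG.fderiv_right (m := (⊤ : ℕ∞)) le_rfl).clm_apply contDiff_const

lemma ContDiff.differentiable_top (hG : ContDiff ℝ (⊤ : ℕ∞) G) : Differentiable ℝ G :=
  hG.differentiable (by simp)

lemma dirDeriv_comm (hG : ContDiff ℝ (⊤ : ℕ∞) G) (v w x : E) :
    dirDeriv v (dirDeriv w G) x = dirDeriv w (dirDeriv v G) x := by
  have hd : Differentiable ℝ (fderiv ℝ G) :=
    (hG.fderiv_right (m := (⊤ : ℕ∞)) le_rfl).differentiable (by simp)
  have key (a b : E) : dirDeriv a (dirDeriv b G) x = fderiv ℝ (fderiv ℝ G) x a b := by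
    change fderiv ℝ (fun y => fderiv ℝ G y b) x a = _
    rw [fderiv_clm_apply (hd x) (differentiableAt_const b)]
    simp
  rw [key, key]
  have h2 : (2 : WithTop ℕ∞) ≤ ((⊤ : ℕ∞) : WithTop ℕ∞) :=
    WithTop.coe_le_coe.2 (le_top : (2 : ℕ∞) ≤ ⊤)
  exact hG.contDiffAt.isSymmSndFDerivAt (by simpa using h2) v w

lemma dirDeriv_add (hF : Differentiable ℝ F) (hG : Differentiable ℝ G) (v x : E) :
    dirDeriv v (fun y => F y + G y) x = dirDeriv v F x + dirDeriv v G x := by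
  simp [dirDeriv, fderiv_fun_add (hF x) (hG x)]

lemma dirDeriv_sub (hF : Differentiable ℝ F) (hG : Differentiable ℝ G) (v x : E) :
    dirDeriv v (fun y => F y - G y) x = dirDeriv v F x - dirDeriv v G x := by
  simp [dirDeriv, fderiv_fun_sub (hF x) (hG x)]

lemma dirDeriv_neg (v x : E) : dirDeriv v (fun y => -F y) x = -dirDeriv v F x := by
  simp [dirDeriv]

lemma dirDeriv_mul (hF : Differentiable ℝ F) (hG : Differentiable ℝ G) (v x : E) :
    dirDeriv v (fun y => F y * G y) x = dirDeriv v F x * G x + F x * dirDeriv v G x := by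
  simp [dirDeriv, fderiv_fun_mul (hF x) (hG x)]
  ring

lemma dirDeriv_const_mul (hG : Differentiable ℝ G) (c : ℝ) (v x : E) :
    dirDeriv v (fun y => c * G y) x = c * dirDeriv v G x := by
  simp [dirDeriv, fderiv_const_mul (hG x)]

lemma dirDeriv_div_const (hG : Differentiable ℝ G) (c : ℝ) (v x : E) :
    dirDeriv v (fun y => G y / c) x = dirDeriv v G x / c := by
  simp only [div_eq_inv_mul]
  exact dirDeriv_const_mul hG _ v x

lemma dirDeriv_sum {ι : Type*} {s : Finset ι} {H : ι → E → ℝ}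
    (hH : ∀ i, Differentiable ℝ (H i)) (v x : E) :
    dirDeriv v (fun y => ∑ i ∈ s, H i y) x = ∑ i ∈ s, dirDeriv v (H i) x := by
  simp [dirDeriv, fderiv_fun_sum fun i _ => hH i x]

end DirDeriv

/-- The time direction in extended phase space. -/
def timeDir : ℝ × P6 := (1, 0)

/-- The `i`-th position direction in extended phase space. -/
def posDir (i : Fin 3) : ℝ × P6 := (0, (Pi.single i 1, 0))

/-- The `i`-th momentum direction in extended phase space. -/
def momDir (i : Fin 3) : ℝ × P6 := (0, (0, Pi.single i 1))

section Slices

variable {G : ℝ × P6 → ℝ}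

lemma fderiv_slice (hG : Differentiable ℝ G) (t : ℝ) (z v : P6) :
    fderiv ℝ (fun w => G (t, w)) z v = dirDeriv (0, v) G (t, z) := by
  have h := (hG (t, z)).hasFDerivAt.comp z (hasFDerivAt_prodMk_right t z)
  change fderiv ℝ (G ∘ fun w => (t, w)) z v = _
  rw [h.fderiv]
  simp [dirDeriv]

lemma dq3_slice (hG : Differentiable ℝ G) (t : ℝ) (z : P6) (i : Fin 3) :
    dq3 (fun w => G (t, w)) z i = dirDeriv (posDir i) G (t, z) :=
  fderiv_slice hG t z _

lemma dp3_slice (hG : Differentiable ℝ G) (t : ℝ) (z : P6) (i : Fin 3) :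
    dp3 (fun w => G (t, w)) z i = dirDeriv (momDir i) G (t, z) :=
  fderiv_slice hG t z _

lemma deriv_time_slice (hG : Differentiable ℝ G) (t : ℝ) (z : P6) :
    deriv (fun s => G (s, z)) t = dirDeriv timeDir G (t, z) := by
  have h := HasFDerivAt.comp (f := fun s : ℝ => (s, z)) t (hG (t, z)).hasFDerivAt
    (hasFDerivAt_prodMk_left t z)
  change deriv (G ∘ fun s => (s, z)) t = _
  rw [h.hasDerivAt.deriv]
  simp [dirDeriv, timeDir]

end Slices

/-- A time-dependent potential viewed as a function on extended phase space. -/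
def liftPot (φ : ℝ × E3 → ℝ) (x : ℝ × P6) : ℝ := φ (x.1, x.2.1)

lemma contDiff_liftPot {φ : ℝ × E3 → ℝ} (hφ : ContDiff ℝ (⊤ : ℕ∞) φ) :
    ContDiff ℝ (⊤ : ℕ∞) (liftPot φ) :=
  hφ.comp (by fun_prop : ContDiff ℝ (⊤ : ℕ∞) fun x : ℝ × P6 => (x.1, x.2.1))

lemma dirDeriv_posDir_of_position {H : ℝ × P6 → ℝ} (hH : Differentiable ℝ H) (t : ℝ) (z : P6)
    (i : Fin 3) :
    fderiv ℝ (fun q => H (t, (q, z.2))) z.1 (Pi.single i 1) = dirDeriv (posDir i) H (t, z) := by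
  have h₁ := HasFDerivAt.comp (f := fun q : E3 => (q, z.2)) z.1
    (hasFDerivAt_prodMk_right (𝕜 := ℝ) t (z.1, z.2)) (hasFDerivAt_prodMk_left z.1 z.2)
  have h := HasFDerivAt.comp (g := H) z.1 (hH (t, z)).hasFDerivAt h₁
  change fderiv ℝ (H ∘ (fun w => (t, w)) ∘ fun q => (q, z.2)) z.1 _ = _
  rw [h.fderiv]
  simp [dirDeriv, posDir]

lemma fderiv_pot {φ : ℝ × E3 → ℝ} (hφ : ContDiff ℝ (⊤ : ℕ∞) φ) (t : ℝ) (z : P6) (i : Fin 3) :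
    fderiv ℝ (fun q => φ (t, q)) z.1 (Pi.single i 1)
      = dirDeriv (posDir i) (liftPot φ) (t, z) :=
  dirDeriv_posDir_of_position (contDiff_liftPot hφ).differentiable_top t z i

lemma d2φ_pot {φ : ℝ × E3 → ℝ} (hφ : ContDiff ℝ (⊤ : ℕ∞) φ) (t : ℝ) (z : P6) (i j : Fin 3) :
    d2φ (fun q => φ (t, q)) z.1 i j
      = dirDeriv (posDir i) (dirDeriv (posDir j) (liftPot φ)) (t, z) := by
  rw [← dirDeriv_posDir_of_position
    (contDiff_dirDeriv (contDiff_liftPot hφ) (posDir j)).differentiable_top]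
  unfold d2φ
  congr 2
  funext q
  exact fderiv_pot hφ t (q, z.2) j

/-- The potential gradient does not depend on the momentum. -/
lemma dirDeriv_momDir_posDir_liftPot {φ : ℝ × E3 → ℝ} (hφ : ContDiff ℝ (⊤ : ℕ∞) φ)
    (i j : Fin 3) (x : ℝ × P6) :
    dirDeriv (momDir j) (dirDeriv (posDir i) (liftPot φ)) x = 0 := by
  rw [dirDeriv_comm (contDiff_liftPot hφ)]
  have h : dirDeriv (momDir j) (liftPot φ) = fun _ => 0 := by
    funext y
    have h₁ : HasFDerivAt (fun x : ℝ × P6 => (x.1, x.2.1))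
        ((ContinuousLinearMap.fst ℝ ℝ P6).prod
          ((ContinuousLinearMap.fst ℝ E3 E3).comp (ContinuousLinearMap.snd ℝ ℝ P6))) y :=
      hasFDerivAt_fst.prodMk (hasFDerivAt_fst.comp y hasFDerivAt_snd)
    have h₂ := ((hφ.differentiable (by simp)) (y.1, y.2.1)).hasFDerivAt.comp y h₁
    change fderiv ℝ (φ ∘ fun x : ℝ × P6 => (x.1, x.2.1)) y _ = 0
    rw [h₂.fderiv]
    exact map_zero (fderiv ℝ φ (y.1, y.2.1))
  simp [h, dirDeriv]

/-- The particle Hamiltonian vector field acting on functions on extended phase space. -/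
def extXact (e m : ℝ) (Φ G : ℝ × P6 → ℝ) (x : ℝ × P6) : ℝ :=
  (∑ i, (x.2.2 i / m) * dirDeriv (posDir i) G x)
    - ∑ i, e * dirDeriv (posDir i) Φ x * dirDeriv (momDir i) G x

lemma Xact_slice {φ : ℝ × E3 → ℝ} (hφ : ContDiff ℝ (⊤ : ℕ∞) φ) {G : ℝ × P6 → ℝ}
    (hG : Differentiable ℝ G) (e m t : ℝ) (z : P6) :
    Xact e m (fun q => φ (t, q)) (fun w => G (t, w)) z
      = extXact e m (liftPot φ) G (t, z) := by
  simp only [Xact, extXact, dq3_slice hG, dp3_slice hG, fderiv_pot hφ]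

section Commutators

variable {Φ G : ℝ × P6 → ℝ}

lemma contDiff_extXact (hΦ : ContDiff ℝ (⊤ : ℕ∞) Φ) (hG : ContDiff ℝ (⊤ : ℕ∞) G) (e m : ℝ) :
    ContDiff ℝ (⊤ : ℕ∞) (extXact e m Φ G) := by
  have h₁ := contDiff_dirDeriv hΦ
  have h₂ := contDiff_dirDeriv hG
  unfold extXact
  fun_prop

lemma dirDeriv_momentum (v x : ℝ × P6) (i : Fin 3) (m : ℝ) :
    dirDeriv v (fun y : ℝ × P6 => y.2.2 i / m) x = v.2.2 i / m := by
  rw [dirDeriv_div_const (by fun_prop)]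
  let L : ℝ × P6 →L[ℝ] ℝ := (ContinuousLinearMap.proj (R := ℝ) (φ := fun _ : Fin 3 => ℝ) i).comp
    ((ContinuousLinearMap.snd ℝ E3 E3).comp (ContinuousLinearMap.snd ℝ ℝ P6))
  have h : HasFDerivAt (fun y : ℝ × P6 => y.2.2 i) L x := L.hasFDerivAt
  simp [dirDeriv, h.fderiv, L]

/-- The commutator of a constant direction with the Hamiltonian vector field. -/
lemma dirDeriv_extXact (hΦ : ContDiff ℝ (⊤ : ℕ∞) Φ) (hG : ContDiff ℝ (⊤ : ℕ∞) G) (e m : ℝ)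
    (v x : ℝ × P6) :
    dirDeriv v (extXact e m Φ G) x
      = extXact e m Φ (dirDeriv v G) x + (∑ i, v.2.2 i / m * dirDeriv (posDir i) G x)
        - ∑ i, e * dirDeriv v (dirDeriv (posDir i) Φ) x * dirDeriv (momDir i) G x := by
  have h₁ (w) := (contDiff_dirDeriv hΦ w).differentiable_top
  have h₂ (w) := (contDiff_dirDeriv hG w).differentiable_top
  change dirDeriv v (fun y => (∑ i, (y.2.2 i / m) * dirDeriv (posDir i) G y)
    - ∑ i, e * dirDeriv (posDir i) Φ y * dirDeriv (momDir i) G y) x = _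
  rw [dirDeriv_sub (by fun_prop) (by fun_prop), dirDeriv_sum (fun i => by fun_prop),
    dirDeriv_sum (fun i => by fun_prop)]
  have h₃ (i : Fin 3) :
      dirDeriv v (fun y => y.2.2 i / m * dirDeriv (posDir i) G y) x
        = v.2.2 i / m * dirDeriv (posDir i) G x
          + x.2.2 i / m * dirDeriv (posDir i) (dirDeriv v G) x := by
    rw [dirDeriv_mul (by fun_prop) (h₂ _), dirDeriv_momentum, dirDeriv_comm hG]
  have h₄ (i : Fin 3) :
      dirDeriv v (fun y => e * dirDeriv (posDir i) Φ y * dirDeriv (momDir i) G y) x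
        = e * dirDeriv v (dirDeriv (posDir i) Φ) x * dirDeriv (momDir i) G x
          + e * dirDeriv (posDir i) Φ x * dirDeriv (momDir i) (dirDeriv v G) x := by
    rw [dirDeriv_mul (by fun_prop) (h₂ _), dirDeriv_const_mul (h₁ _), dirDeriv_comm hG]
  simp only [h₃, h₄, Finset.sum_add_distrib, extXact]
  ring

end Commutators

/-- If `Π = (Π_q, Π_p)` satisfies the momentum-Vlasov equations, then
`f = ∇_p·Π_q − ∇_q·Π_p` satisfies the Vlasov equation
`∂f/∂t + (p/m)·∇_q f − e∇_qφ·∇_p f = 0`. -/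
theorem stmt10 (e m : ℝ) (hm : m ≠ 0) (φ : ℝ × E3 → ℝ) (Pim : ℝ × P6 → E3 × E3)
    (hφ : ContDiff ℝ (⊤ : ℕ∞) φ) (hPim : ContDiff ℝ (⊤ : ℕ∞) Pim)
    (hq : ∀ (t : ℝ) (z : P6) (j : Fin 3),
      deriv (fun t' => (Pim (t', z)).1 j) t
        = -(Xact e m (fun q => φ (t, q)) (fun w => (Pim (t, w)).1 j) z)
          + e * ∑ i, (Pim (t, z)).2 i * d2φ (fun q => φ (t, q)) z.1 i j)
    (hp : ∀ (t : ℝ) (z : P6) (j : Fin 3),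
      deriv (fun t' => (Pim (t', z)).2 j) t
        = -(Xact e m (fun q => φ (t, q)) (fun w => (Pim (t, w)).2 j) z)
          - (Pim (t, z)).1 j / m) :
    ∀ (t : ℝ) (z : P6),
      deriv (fun t' => dens Pim t' z) t
        + Xact e m (fun q => φ (t, q)) (dens Pim t) z = 0 := by
  intro t z
  have hΦ := contDiff_liftPot hφ
  set Φ := liftPot φ with hΦ_def
  let Q (j : Fin 3) (x : ℝ × P6) : ℝ := (Pim x).1 j
  let P (j : Fin 3) (x : ℝ × P6) : ℝ := (Pim x).2 j
  have hQ (j) : ContDiff ℝ (⊤ : ℕ∞) (Q j) := by fun_prop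
  have hP (j) : ContDiff ℝ (⊤ : ℕ∞) (P j) := by fun_prop
  have hQd (j) := (hQ j).differentiable_top
  have hPd (j) := (hP j).differentiable_top
  let f (x : ℝ × P6) : ℝ :=
    (∑ i, dirDeriv (momDir i) (Q i) x) - ∑ i, dirDeriv (posDir i) (P i) x
  have hQ' (j v) := contDiff_dirDeriv (hQ j) v
  have hP' (j v) := contDiff_dirDeriv (hP j) v
  have hQd' (j v) := (hQ' j v).differentiable_top
  have hPd' (j v) := (hP' j v).differentiable_top
  have hfd : Differentiable ℝ f := by fun_prop
  have hf (s : ℝ) : dens Pim s = fun w => f (s, w) := by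
    funext w
    exact congrArg₂ (· - ·) (Finset.sum_congr rfl fun i _ => dp3_slice (hQd i) s w i)
      (Finset.sum_congr rfl fun i _ => dq3_slice (hPd i) s w i)
  have hQt (j) : dirDeriv timeDir (Q j) = fun x =>
      -extXact e m Φ (Q j) x
        + e * ∑ i, P i x * dirDeriv (posDir i) (dirDeriv (posDir j) Φ) x := by
    funext x
    have h := hq x.1 x.2 j
    simp only [d2φ_pot hφ] at h
    exact (deriv_time_slice (hQd j) x.1 x.2).symm.trans
      (h.trans (by rw [Xact_slice hφ (hQd j)]))
  have hPt (j) : dirDeriv timeDir (P j) = fun x =>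
      -extXact e m Φ (P j) x - Q j x / m := by
    funext x
    exact (deriv_time_slice (hPd j) x.1 x.2).symm.trans
      ((hp x.1 x.2 j).trans (by rw [Xact_slice hφ (hPd j)]))
  have hdf (v : ℝ × P6) (x : ℝ × P6) : dirDeriv v f x
      = (∑ i, dirDeriv v (dirDeriv (momDir i) (Q i)) x)
        - ∑ i, dirDeriv v (dirDeriv (posDir i) (P i)) x := by
    rw [← dirDeriv_sum (fun i => hQd' i _), ← dirDeriv_sum (fun i => hPd' i _)]
    exact dirDeriv_sub (by fun_prop) (by fun_prop) v x
  have hXQ (j) := (contDiff_extXact hΦ (hQ j) e m).differentiable_top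
  have hXP (j) := (contDiff_extXact hΦ (hP j) e m).differentiable_top
  have hΦ2 (i j) := contDiff_dirDeriv (contDiff_dirDeriv hΦ (posDir j)) (posDir i)
  have hΦ2d (i j) := (hΦ2 i j).differentiable_top
  have hΦ3 (i j k x) :
      dirDeriv (momDir k) (dirDeriv (posDir i) (dirDeriv (posDir j) Φ)) x = 0 := by
    rw [dirDeriv_comm (contDiff_dirDeriv hΦ _),
      funext (dirDeriv_momDir_posDir_liftPot hφ j k)]
    simp [dirDeriv]
  have hQtp (j x) : dirDeriv timeDir (dirDeriv (momDir j) (Q j)) x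
      = -(extXact e m Φ (dirDeriv (momDir j) (Q j)) x + dirDeriv (posDir j) (Q j) x / m)
        + e * ∑ i, dirDeriv (momDir j) (P i) x
          * dirDeriv (posDir i) (dirDeriv (posDir j) Φ) x := by
    have hmul (i) : dirDeriv (momDir j)
        (fun y => P i y * dirDeriv (posDir i) (dirDeriv (posDir j) Φ) y) x
        = dirDeriv (momDir j) (P i) x * dirDeriv (posDir i) (dirDeriv (posDir j) Φ) x := by
      rw [dirDeriv_mul (hPd i) (hΦ2d i j), hΦ3, mul_zero, add_zero]
    rw [dirDeriv_comm (hQ j), hQt, dirDeriv_add (by fun_prop) (by fun_prop), dirDeriv_neg,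
      dirDeriv_extXact hΦ (hQ j), dirDeriv_const_mul (by fun_prop),
      dirDeriv_sum (fun i => by fun_prop)]
    simp only [hmul]
    simp only [hΦ_def, dirDeriv_momDir_posDir_liftPot hφ]
    simp [momDir, Pi.single_apply, ite_mul, div_eq_inv_mul]
  have hPtq (j x) : dirDeriv timeDir (dirDeriv (posDir j) (P j)) x
      = -(extXact e m Φ (dirDeriv (posDir j) (P j)) x
          - ∑ i, e * dirDeriv (posDir j) (dirDeriv (posDir i) Φ) x * dirDeriv (momDir i) (P j) x)
        - dirDeriv (posDir j) (Q j) x / m := by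
    rw [dirDeriv_comm (hP j), hPt, dirDeriv_sub (by fun_prop) (by fun_prop), dirDeriv_neg,
      dirDeriv_extXact hΦ (hP j), dirDeriv_div_const (hQd j)]
    simp [posDir]
  rw [hf t, Xact_slice hφ hfd, ← hΦ_def]
  simp only [hf]
  rw [deriv_time_slice hfd, hdf]
  simp only [hQtp, hPtq]
  simp only [extXact, hdf, Fin.sum_univ_three]
  ring
end
end

section
/- For a smooth function h : ℝ² → ℝ of the variables (q,p) only, define the strict contact (quantomorphism) lift on ℝ³ by X_h^{st}(q,p,s) = (∂h/∂p, −∂h/∂q, p∂h/∂p − h). Then: (i) X_h^{st} preserves the contact form σ = p dq − ds exactly, i.e. the Lie derivative L_{X_h^{st}} σ vanishes identically; and (ii) for all smooth h, k : ℝ² → ℝ, the Jacobi–Lie bracket satisfies [X_h^{st}, X_k^{st}] = −X_{{h,k}}^{st}, where {h,k} = (∂h/∂q)(∂k/∂p) − (∂h/∂p)(∂k/∂q) is the canonical Poisson bracket on ℝ². Hence h ↦ X_h^{st} is an anti-homomorphism from the Poisson algebra of functions on ℝ² into the Lie algebra of infinitesimal quantomorphisms. -/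
noncomputable section

/-- The contact manifold `ℝ³` with coordinates `(q,p,s)`. -/
abbrev C3 := ℝ × ℝ × ℝ

/-- Partial derivatives of functions of `(q,p) ∈ ℝ²`. -/
def dq2 (h : ℝ × ℝ → ℝ) (w : ℝ × ℝ) : ℝ := fderiv ℝ h w (1, 0)
def dp2 (h : ℝ × ℝ → ℝ) (w : ℝ × ℝ) : ℝ := fderiv ℝ h w (0, 1)

/-- Canonical Poisson bracket on `ℝ²`:
`{h,k} = (∂h/∂q)(∂k/∂p) − (∂h/∂p)(∂k/∂q)`. -/
def pb2 (h k : ℝ × ℝ → ℝ) (w : ℝ × ℝ) : ℝ := dq2 h w * dp2 k w - dp2 h w * dq2 k w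

/-- Strict contact (quantomorphism) lift
`X_h^{st}(q,p,s) = (∂h/∂p, −∂h/∂q, p ∂h/∂p − h)`. -/
def Xst (h : ℝ × ℝ → ℝ) (z : C3) : C3 :=
  (dp2 h (z.1, z.2.1), -(dq2 h (z.1, z.2.1)),
    z.2.1 * dp2 h (z.1, z.2.1) - h (z.1, z.2.1))

/-- The contact form `σ = p dq − ds` as a covector field `(p, 0, −1)`. -/
def sigma3 (z : C3) : C3 := (z.2.1, 0, -1)

def pairC (a v : C3) : ℝ := a.1 * v.1 + a.2.1 * v.2.1 + a.2.2 * v.2.2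

/-- Lie derivative of a covector field `α` along `X`. -/
def lieCov (X α : C3 → C3) (z v : C3) : ℝ :=
  pairC (fderiv ℝ α z (X z)) v + pairC (α z) (fderiv ℝ X z v)

/-- Expansion of a linear functional on `ℝ²` in the standard basis. -/
theorem ContinuousLinearMap.apply_prod_eq (L : ℝ × ℝ →L[ℝ] ℝ) (a b : ℝ) :
    L (a, b) = a * L (1, 0) + b * L (0, 1) := by
  have hab : ((a, b) : ℝ × ℝ) = a • ((1, 0) : ℝ × ℝ) + b • ((0, 1) : ℝ × ℝ) := by simp
  rw [hab, map_add, map_smul, map_smul, smul_eq_mul, smul_eq_mul]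

theorem ContDiff.differentiable_fderiv_of_smooth {h : ℝ × ℝ → ℝ}
    (hh : ContDiff ℝ (⊤ : ℕ∞) h) : Differentiable ℝ (fderiv ℝ h) :=
  (hh.fderiv_right (m := 1) (by norm_cast)).differentiable (by norm_num)

theorem differentiable_dq2 {h : ℝ × ℝ → ℝ} (hh : ContDiff ℝ (⊤ : ℕ∞) h) :
    Differentiable ℝ (dq2 h) :=
  fun w => (hh.differentiable_fderiv_of_smooth w).clm_apply (differentiableAt_const _)

theorem differentiable_dp2 {h : ℝ × ℝ → ℝ} (hh : ContDiff ℝ (⊤ : ℕ∞) h) :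
    Differentiable ℝ (dp2 h) :=
  fun w => (hh.differentiable_fderiv_of_smooth w).clm_apply (differentiableAt_const _)

/-- Mixed partial derivatives of a smooth function commute. -/
theorem dq2_dp2_comm {h : ℝ × ℝ → ℝ} (hh : ContDiff ℝ (⊤ : ℕ∞) h) (w : ℝ × ℝ) :
    dq2 (dp2 h) w = dp2 (dq2 h) w := by
  have hd := hh.differentiable_fderiv_of_smooth w
  have hp : fderiv ℝ (dp2 h) w (1, 0) = fderiv ℝ (fderiv ℝ h) w (1, 0) (0, 1) := by
    have := (hd.hasFDerivAt.clm_apply (hasFDerivAt_const ((0, 1) : ℝ × ℝ) w)).fderiv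
    change fderiv ℝ (fun y => fderiv ℝ h y (0, 1)) w (1, 0) = _
    rw [this]
    simp
  have hq : fderiv ℝ (dq2 h) w (0, 1) = fderiv ℝ (fderiv ℝ h) w (0, 1) (1, 0) := by
    have := (hd.hasFDerivAt.clm_apply (hasFDerivAt_const ((1, 0) : ℝ × ℝ) w)).fderiv
    change fderiv ℝ (fun y => fderiv ℝ h y (1, 0)) w (0, 1) = _
    rw [this]
    simp
  have hs : IsSymmSndFDerivAt ℝ h w :=
    hh.contDiffAt.isSymmSndFDerivAt
      (by simp only [minSmoothness_of_isRCLikeNormedField]; norm_cast)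
  rw [dq2, dp2, hp, hq]
  exact hs _ _

/-- The derivative of the strict contact lift. -/
theorem fderiv_Xst_apply {h : ℝ × ℝ → ℝ} (hh : ContDiff ℝ (⊤ : ℕ∞) h) (z v : C3) :
    fderiv ℝ (Xst h) z v =
      (v.1 * dq2 (dp2 h) (z.1, z.2.1) + v.2.1 * dp2 (dp2 h) (z.1, z.2.1),
        -(v.1 * dq2 (dq2 h) (z.1, z.2.1) + v.2.1 * dp2 (dq2 h) (z.1, z.2.1)),
        z.2.1 * (v.1 * dq2 (dp2 h) (z.1, z.2.1) + v.2.1 * dp2 (dp2 h) (z.1, z.2.1))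
          - v.1 * dq2 h (z.1, z.2.1)) := by
  have hπ₂ : HasFDerivAt (fun z : C3 => z.2.1) _ z :=
    (hasFDerivAt_snd (𝕜 := ℝ) (p := z)).fst
  have hπ : HasFDerivAt (fun z : C3 => (z.1, z.2.1)) _ z :=
    (hasFDerivAt_fst (𝕜 := ℝ) (p := z)).prodMk hπ₂
  have comp {f : ℝ × ℝ → ℝ} (hf : Differentiable ℝ f) :=
    (hf (z.1, z.2.1)).hasFDerivAt.comp z hπ
  have hP := comp (differentiable_dp2 hh)
  have hQ := comp (differentiable_dq2 hh)
  have hH := comp (hh.differentiable (by norm_num))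
  have hX : HasFDerivAt (Xst h) _ z := hP.prodMk (hQ.neg.prodMk ((hπ₂.mul hP).sub hH))
  rw [hX.fderiv]
  simp [ContinuousLinearMap.apply_prod_eq _ v.1 v.2.1, dq2, dp2]
  ring

theorem fderiv_pb2_apply {h k : ℝ × ℝ → ℝ} (hh : ContDiff ℝ (⊤ : ℕ∞) h)
    (hk : ContDiff ℝ (⊤ : ℕ∞) k) (w u : ℝ × ℝ) :
    fderiv ℝ (pb2 h k) w u =
      dq2 h w * fderiv ℝ (dp2 k) w u + dp2 k w * fderiv ℝ (dq2 h) w u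
        - (dp2 h w * fderiv ℝ (dq2 k) w u + dq2 k w * fderiv ℝ (dp2 h) w u) := by
  have hb : HasFDerivAt (pb2 h k) _ w :=
    (((differentiable_dq2 hh w).hasFDerivAt.mul (differentiable_dp2 hk w).hasFDerivAt)).sub
      ((differentiable_dp2 hh w).hasFDerivAt.mul (differentiable_dq2 hk w).hasFDerivAt)
  rw [hb.fderiv]
  simp

theorem fderiv_sigma3_apply (z v : C3) : fderiv ℝ sigma3 z v = (v.2.1, 0, 0) := by
  have hs : HasFDerivAt sigma3 _ z :=
    (hasFDerivAt_snd (𝕜 := ℝ) (p := z)).fst.prodMk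
      (hasFDerivAt_const ((0, -1) : ℝ × ℝ) z)
  rw [hs.fderiv]
  rfl

/-- (i) `X_h^{st}` preserves `σ` exactly: `L_{X_h^{st}} σ = 0`; and (ii)
`[X_h^{st}, X_k^{st}] = −X_{{h,k}}^{st}`, so `h ↦ X_h^{st}` is an anti-homomorphism
from the Poisson algebra on `ℝ²` into the Lie algebra of infinitesimal
quantomorphisms. -/
theorem stmt15 (h k : ℝ × ℝ → ℝ) (hh : ContDiff ℝ (⊤ : ℕ∞) h) (hk : ContDiff ℝ (⊤ : ℕ∞) k) :
    (∀ z v, lieCov (Xst h) sigma3 z v = 0) ∧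
    jacobiLie (Xst h) (Xst k) = fun z => -(Xst (pb2 h k) z) := by
  refine ⟨fun z v => ?_, funext fun z => ?_⟩
  · rw [lieCov, fderiv_sigma3_apply, fderiv_Xst_apply hh]
    simp only [pairC, Xst, sigma3]
    ring
  · have hq : dq2 (pb2 h k) (z.1, z.2.1) = _ := fderiv_pb2_apply hh hk (z.1, z.2.1) (1, 0)
    have hp : dp2 (pb2 h k) (z.1, z.2.1) = _ := fderiv_pb2_apply hh hk (z.1, z.2.1) (0, 1)
    simp only [← dq2.eq_def, ← dp2.eq_def] at hq hp
    rw [jacobiLie, fderiv_Xst_apply hk, fderiv_Xst_apply hh]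
    simp only [Xst, hq, hp, dq2_dp2_comm hh, dq2_dp2_comm hk, pb2, Prod.mk_sub_mk, Prod.neg_mk,
      Prod.mk.injEq]
    refine ⟨?_, ?_, ?_⟩ <;> ring
end
end

section
/- Let H : ℝ³ → ℝ be smooth and let Γ = (Γ_q, Γ_p, Γ_s) : ℝ³ → ℝ³ be a smooth compactly supported covector field on ℝ³. Then the L²-pairing of Γ with the contact Hamiltonian vector field X_H satisfies ∫_{ℝ³} [Γ_q ∂H/∂p − Γ_p(∂H/∂q + p∂H/∂s) + Γ_s(p∂H/∂p − H)] dq dp ds = ∫_{ℝ³} H · F_Γ dq dp ds, where F_Γ = ∂Γ_p/∂q − ∂Γ_q/∂p + p∂Γ_p/∂s − p∂Γ_s/∂p − 2Γ_s is the function with F_Γ·dμ = 2Γ∧dσ − dΓ∧σ (dμ = dq∧dp∧ds the contact volume). In particular the pairing of Γ with every contact Hamiltonian vector field is determined by the single density F_Γ. -/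
open MeasureTheory

noncomputable section

def dQ (H : C3 → ℝ) (z : C3) : ℝ := fderiv ℝ H z (1, 0, 0)
def dP (H : C3 → ℝ) (z : C3) : ℝ := fderiv ℝ H z (0, 1, 0)
def dS (H : C3 → ℝ) (z : C3) : ℝ := fderiv ℝ H z (0, 0, 1)

/-- The density `F_Γ = ∂Γ_p/∂q − ∂Γ_q/∂p + p ∂Γ_p/∂s − p ∂Γ_s/∂p − 2Γ_s`
(so that `F_Γ·dμ = 2Γ∧dσ − dΓ∧σ`). -/
def Fdens (Γ : C3 → C3) (z : C3) : ℝ :=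
  dQ (fun w => (Γ w).2.1) z - dP (fun w => (Γ w).1) z +
    z.2.1 * dS (fun w => (Γ w).2.1) z - z.2.1 * dP (fun w => (Γ w).2.2) z -
    2 * (Γ z).2.2

theorem integrable_fderiv_apply {u : C3 → ℝ} (hu : ContDiff ℝ 1 u) (hc : HasCompactSupport u)
    (v : C3) : Integrable (fun z => fderiv ℝ u z v) :=
  ((hu.continuous_fderiv one_ne_zero).clm_apply continuous_const).integrable_of_hasCompactSupport
    (hc.fderiv_apply ℝ v)

theorem integral_fderiv_apply_eq_zero {u : C3 → ℝ} (hu : ContDiff ℝ 1 u)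
    (hc : HasCompactSupport u) (v : C3) : ∫ z, fderiv ℝ u z v = 0 := by
  have : (volume : Measure (ℝ × ℝ)).IsAddHaarMeasure :=
    Measure.prod.instIsAddHaarMeasure volume volume
  have : (volume : Measure C3).IsAddHaarMeasure :=
    Measure.prod.instIsAddHaarMeasure volume volume
  have h := integral_mul_fderiv_eq_neg_fderiv_mul_of_integrable (μ := (volume : Measure C3))
    (f := fun _ : C3 => (1 : ℝ)) (g := u) (v := v) (by simp)
    (by simpa using integrable_fderiv_apply hu hc v)
    (by simpa using hu.continuous.integrable_of_hasCompactSupport hc)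
    (fun x _ => differentiableAt_const _)
    (fun x _ => hu.differentiable one_ne_zero x)
  simpa using h

theorem fderiv_mul_apply {f g : C3 → ℝ} (hf : ContDiff ℝ 1 f) (hg : ContDiff ℝ 1 g) (z v : C3) :
    fderiv ℝ (fun w => f w * g w) z v = f z * fderiv ℝ g z v + g z * fderiv ℝ f z v := by
  rw [fderiv_fun_mul (hf.differentiable one_ne_zero z) (hg.differentiable one_ne_zero z)]
  simp

theorem fderiv_momentum_apply (z v : C3) : fderiv ℝ (fun w : C3 => w.2.1) z v = v.2.1 := by
  have h : HasFDerivAt (fun w : C3 => w.2.1)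
      ((ContinuousLinearMap.fst ℝ ℝ ℝ).comp (ContinuousLinearMap.snd ℝ ℝ (ℝ × ℝ))) z :=
    ((ContinuousLinearMap.fst ℝ ℝ ℝ).comp
      (ContinuousLinearMap.snd ℝ ℝ (ℝ × ℝ))).hasFDerivAt
  rw [h.fderiv]
  rfl

/-- L²-pairing of a compactly supported covector field `Γ = (Γ_q, Γ_p, Γ_s)` with the
contact Hamiltonian vector field `X_H` equals the integral of `H · F_Γ`. -/
theorem stmt16 (H : C3 → ℝ) (hH : ContDiff ℝ (⊤ : ℕ∞) H)
    (Γ : C3 → C3) (hΓ : ContDiff ℝ (⊤ : ℕ∞) Γ) (hΓc : HasCompactSupport Γ) :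
    (∫ z : C3, ((Γ z).1 * dP H z - (Γ z).2.1 * (dQ H z + z.2.1 * dS H z)
        + (Γ z).2.2 * (z.2.1 * dP H z - H z)))
      = ∫ z : C3, H z * Fdens Γ z := by
  have hH1 : ContDiff ℝ 1 H := hH.of_le (mod_cast le_top)
  have hΓ1 : ContDiff ℝ 1 Γ := hΓ.of_le (mod_cast le_top)
  have ha : ContDiff ℝ 1 (fun w => (Γ w).1) := hΓ1.fst
  have hb : ContDiff ℝ 1 (fun w => (Γ w).2.1) := hΓ1.snd.fst
  have hc : ContDiff ℝ 1 (fun w => (Γ w).2.2) := hΓ1.snd.snd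
  have hp : ContDiff ℝ 1 (fun w : C3 => w.2.1) := contDiff_snd.fst
  have ca : HasCompactSupport (fun w => (Γ w).1) := hΓc.comp_left (g := fun x : C3 => x.1) rfl
  have cb : HasCompactSupport (fun w => (Γ w).2.1) := hΓc.comp_left (g := fun x : C3 => x.2.1) rfl
  have cc : HasCompactSupport (fun w => (Γ w).2.2) := hΓc.comp_left (g := fun x : C3 => x.2.2) rfl
  have hpb := hp.mul hb
  have hpc := hp.mul hc
  have cpb : HasCompactSupport (fun w : C3 => w.2.1 * (Γ w).2.1) := cb.mul_left
  have cpc : HasCompactSupport (fun w : C3 => w.2.1 * (Γ w).2.2) := cc.mul_left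
  have cHa : HasCompactSupport (fun w => H w * (Γ w).1) := ca.mul_left
  have cHb : HasCompactSupport (fun w => H w * (Γ w).2.1) := cb.mul_left
  have cHpb : HasCompactSupport (fun w : C3 => H w * (w.2.1 * (Γ w).2.1)) := cpb.mul_left
  have cHpc : HasCompactSupport (fun w : C3 => H w * (w.2.1 * (Γ w).2.2)) := cpc.mul_left
  have ia := integrable_fderiv_apply (hH1.mul ha) cHa (0, 1, 0)
  have ib := integrable_fderiv_apply (hH1.mul hb) cHb (1, 0, 0)
  have ipb := integrable_fderiv_apply (hH1.mul hpb) cHpb (0, 0, 1)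
  have ipc := integrable_fderiv_apply (hH1.mul hpc) cHpc (0, 1, 0)
  have hF : Integrable (fun z => H z * Fdens Γ z) := by
    have cont {f : C3 → ℝ} (hf : ContDiff ℝ 1 f) (v : C3) :
        Continuous (fun z => fderiv ℝ f z v) :=
      (hf.continuous_fderiv one_ne_zero).clm_apply continuous_const
    have hcont : Continuous (Fdens Γ) :=
      ((((cont hb _).sub (cont ha _)).add (hp.continuous.mul (cont hb _))).sub
        (hp.continuous.mul (cont hc _))).sub (continuous_const.mul hc.continuous)
    have hcs : HasCompactSupport (Fdens Γ) :=
      ((((cb.fderiv_apply ℝ _).sub (ca.fderiv_apply ℝ _)).add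
        (cb.fderiv_apply ℝ _).mul_left).sub (cc.fderiv_apply ℝ _).mul_left).sub cc.mul_left
    exact (hH1.continuous.mul hcont).integrable_of_hasCompactSupport hcs.mul_left
  have key : ∀ z : C3, (Γ z).1 * dP H z - (Γ z).2.1 * (dQ H z + z.2.1 * dS H z)
        + (Γ z).2.2 * (z.2.1 * dP H z - H z) = H z * Fdens Γ z +
      (fderiv ℝ (fun w => H w * (Γ w).1) z (0, 1, 0)
        - fderiv ℝ (fun w => H w * (Γ w).2.1) z (1, 0, 0)
        - fderiv ℝ (fun w => H w * (w.2.1 * (Γ w).2.1)) z (0, 0, 1)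
        + fderiv ℝ (fun w => H w * (w.2.1 * (Γ w).2.2)) z (0, 1, 0)) := by
    intro z
    rw [fderiv_mul_apply hH1 ha, fderiv_mul_apply hH1 hb, fderiv_mul_apply hH1 hpb,
      fderiv_mul_apply hH1 hpc, fderiv_mul_apply hp hb, fderiv_mul_apply hp hc,
      fderiv_momentum_apply, fderiv_momentum_apply]
    simp only [Fdens, dQ, dP, dS]
    ring
  simp_rw [key]
  have iab : Integrable (fun z : C3 => (_ : ℝ) - _) := ia.sub ib
  have iabp : Integrable (fun z : C3 => (_ : ℝ) - _) := iab.sub ipb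
  have isum : Integrable (fun z : C3 => (_ : ℝ) + _) := iabp.add ipc
  rw [integral_add hF isum, integral_add iabp ipc, integral_sub iab ipb, integral_sub ia ib,
    integral_fderiv_apply_eq_zero (hH1.mul ha) cHa, integral_fderiv_apply_eq_zero (hH1.mul hb) cHb,
    integral_fderiv_apply_eq_zero (hH1.mul hpb) cHpb,
    integral_fderiv_apply_eq_zero (hH1.mul hpc) cHpc]
  simp
end
end

section
/- For all smooth functions F, H : ℝ³ → ℝ, the following pointwise identity holds: {H,F}_c − 2 div(X_H)·F = X_F(H) + 4F·(∂H/∂s) + (∂F/∂s)·H, where X_F(H) denotes the directional derivative DH·X_F and div(X_H) = −2∂H/∂s. Equivalently, the Lie–Poisson Hamiltonian operator on contact densities is the first-order linear differential operator J_LP(F) = X_F + 4F ∂/∂s + ∂F/∂s, in the sense that J_LP(F)H = {H,F}_c − 2 div(X_H) F for every smooth H. (In particular this rests on the identity {H,F}_c = X_F(H) + (∂F/∂s)H.) -/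
noncomputable section

/-- Contact Hamiltonian vector field
`X_H = (∂H/∂p, −(∂H/∂q + p ∂H/∂s), p ∂H/∂p − H)`. -/
def Xcon (H : C3 → ℝ) (z : C3) : C3 :=
  (dP H z, -(dQ H z + z.2.1 * dS H z), z.2.1 * dP H z - H z)

/-- Euclidean divergence. -/
def divC (X : C3 → C3) (z : C3) : ℝ :=
  fderiv ℝ (fun w => (X w).1) z (1, 0, 0) + fderiv ℝ (fun w => (X w).2.1) z (0, 1, 0) +
    fderiv ℝ (fun w => (X w).2.2) z (0, 0, 1)

/-- Lagrange (contact Poisson) bracket. -/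
def lagBracket (K H : C3 → ℝ) (z : C3) : ℝ :=
  dP H z * dQ K z - dQ H z * dP K z + dS K z * (z.2.1 * dP H z - H z) +
    dS H z * (K z - z.2.1 * dP K z)

theorem fderiv_apply_C3 (H : C3 → ℝ) (z v : C3) :
    fderiv ℝ H z v = v.1 * dQ H z + v.2.1 * dP H z + v.2.2 * dS H z := by
  have hv : v = v.1 • ((1, 0, 0) : C3) + v.2.1 • ((0, 1, 0) : C3) + v.2.2 • ((0, 0, 1) : C3) := by
    ext <;> simp
  conv_lhs => rw [hv]
  simp only [map_add, map_smul, smul_eq_mul, dQ, dP, dS]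

theorem hasFDerivAt_fderiv_apply_s18 {H : C3 → ℝ} (hH : ContDiff ℝ 2 H) (z v : C3) :
    HasFDerivAt (fun w => fderiv ℝ H w v) ((fderiv ℝ (fderiv ℝ H) z).flip v) z := by
  have hd : DifferentiableAt ℝ (fderiv ℝ H) z :=
    (hH.fderiv_right (m := 1) (by norm_num)).differentiable one_ne_zero z
  simpa using hd.hasFDerivAt.clm_apply (hasFDerivAt_const v z)

theorem divC_Xcon {H : C3 → ℝ} (hH : ContDiff ℝ 2 H) (z : C3) :
    divC (Xcon H) z = -2 * dS H z := by
  have hsymm : IsSymmSndFDerivAt ℝ H z :=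
    hH.contDiffAt.isSymmSndFDerivAt (by simp)
  have hp : HasFDerivAt (fun w : C3 => w.2.1)
      ((ContinuousLinearMap.fst ℝ ℝ ℝ).comp (ContinuousLinearMap.snd ℝ ℝ (ℝ × ℝ))) z :=
    ((ContinuousLinearMap.fst ℝ ℝ ℝ).comp (ContinuousLinearMap.snd ℝ ℝ (ℝ × ℝ))).hasFDerivAt
  have hQ := hasFDerivAt_fderiv_apply_s18 hH z (1, 0, 0)
  have hP := hasFDerivAt_fderiv_apply_s18 hH z (0, 1, 0)
  have hS := hasFDerivAt_fderiv_apply_s18 hH z (0, 0, 1)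
  have hH1 := (hH.differentiable two_ne_zero z).hasFDerivAt
  have h2 := (hQ.add (hp.mul hS)).neg.fderiv
  have h3 := ((hp.mul hP).sub hH1).fderiv
  have e1 : fderiv ℝ (fun w => (Xcon H w).1) z = _ := hP.fderiv
  have e2 : fderiv ℝ (fun w => (Xcon H w).2.1) z = _ := h2
  have e3 : fderiv ℝ (fun w => (Xcon H w).2.2) z = _ := h3
  have s1 := hsymm (1, 0, 0) (0, 1, 0)
  have s2 := hsymm (0, 1, 0) (0, 0, 1)
  rw [divC, e1, e2, e3]
  simp [dS, s1, s2]
  ring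

theorem lagBracket_eq (F H : C3 → ℝ) (z : C3) :
    lagBracket H F z = fderiv ℝ H z (Xcon F z) + dS F z * H z := by
  rw [fderiv_apply_C3, lagBracket, Xcon]
  ring

/-- The Lie–Poisson Hamiltonian operator on contact densities is the first-order
operator `J_LP(F) = X_F + 4F ∂/∂s + ∂F/∂s`:
`{H,F}_c − 2 div(X_H)·F = X_F(H) + 4F·∂H/∂s + (∂F/∂s)·H`, which rests on the
identity `{H,F}_c = X_F(H) + (∂F/∂s)·H`. -/
theorem stmt18 (F H : C3 → ℝ) (hF : ContDiff ℝ (⊤ : ℕ∞) F) (hH : ContDiff ℝ (⊤ : ℕ∞) H) :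
    (∀ z, lagBracket H F z - 2 * divC (Xcon H) z * F z
        = fderiv ℝ H z (Xcon F z) + 4 * F z * dS H z + dS F z * H z) ∧
    (∀ z, lagBracket H F z = fderiv ℝ H z (Xcon F z) + dS F z * H z) := by
  refine ⟨fun z => ?_, lagBracket_eq F H⟩
  rw [lagBracket_eq, divC_Xcon (contDiff_infty.mp hH 2)]
  ring
end
end
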